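/- arXiv:2005.07291 — 5 statements merged into one kernel-verified Lean document; each statement's English description precedes it below -/
import Mathlib

section
/- Let L ≥ 2, n ≥ 1, and let C ⊆ F_2^{nL} be a linear binary code with projection codes C_1, …, C_L ⊆ F_2^n (C_i is the set of i-th length-n blocks of codewords of C) and antiprojections S_i = {c_i ∈ F_2^n : (0,…,0, c_i, 0,…,0) ∈ C} (the i-th block ranging over all codewords whose other blocks are zero). Suppose C_1 ⊆ S_2 ⊆ C_2 ⊆ S_3 ⊆ C_3 ⊆ … ⊆ C_{L-1} ⊆ S_L ⊆ C_L ⊆ F_2^n, and that for every i = 2, …, L and all c, c' ∈ C_{i-1}, the Schur product c * c' belongs to S_i. Then the Construction C* constellation Γ = {c_1 + 2·c_2 + ⋯ + 2^{L-1}·c_L + 2^L·z : (c_1,…,c_L) ∈ C, z ∈ ℤ^n} is an additive subgroup of ℝ^n (hence a lattice). -/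
open Finset

/-- The natural embedding `ψ : F_2^n → ℤ^n`, sending the bits 0,1 to the integers 0,1. -/
def psi {n : ℕ} (x : Fin n → ZMod 2) : Fin n → ℤ := fun i => ((x i).val : ℤ)

/-- Coordinatewise embedding of `ℤ^n` into `ℝ^n`. -/
def toReal {n : ℕ} (v : Fin n → ℤ) : Fin n → ℝ := fun i => (v i : ℝ)

/-- The `L`-level Construction C* constellation
`Γ = {c_1 + 2 c_2 + ⋯ + 2^{L-1} c_L + 2^L z : (c_1,…,c_L) ∈ C, z ∈ ℤ^n}`. -/
def GammaL {n L : ℕ} (C : Set (Fin L → Fin n → ZMod 2)) : Set (Fin n → ℤ) :=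
  { v | ∃ c ∈ C, ∃ z : Fin n → ℤ,
      v = (∑ i : Fin L, (2 ^ (i : ℕ) : ℤ) • psi (c i)) + (2 ^ L : ℤ) • z }

/-- The projection code `C_i`: the set of `i`-th blocks of codewords of `C`. -/
def Proj {n L : ℕ} (C : Set (Fin L → Fin n → ZMod 2)) (i : Fin L) :
    Set (Fin n → ZMod 2) :=
  { v | ∃ c ∈ C, c i = v }

/-- The antiprojection `S_i(0,…,0)`: the set of `i`-th blocks of codewords of `C` whose
other blocks are all zero. -/
def Anti {n L : ℕ} (C : Set (Fin L → Fin n → ZMod 2)) (i : Fin L) :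
    Set (Fin n → ZMod 2) :=
  { v | (fun j => if j = i then v else 0) ∈ C }

/-- Binary addition of two words with its carry, coordinatewise. -/
theorem psi_add {n : ℕ} (x y : Fin n → ZMod 2) :
    psi x + psi y = psi (x + y) + (2 : ℤ) • psi (x * y) := by
  have key : ∀ a b : ZMod 2,
      (a.val : ℤ) + (b.val : ℤ) = ((a + b).val : ℤ) + 2 * ((a * b).val : ℤ) := by decide
  funext i
  simpa [psi] using key (x i) (y i)

theorem psi_zero {n : ℕ} : psi (0 : Fin n → ZMod 2) = 0 := by
  funext i
  simp [psi]

/-- The integer point `c_1 + 2 c_2 + ⋯ + 2^{L-1} c_L` attached to a word. -/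
def levelSum {n L : ℕ} (c : Fin L → Fin n → ZMod 2) : Fin n → ℤ :=
  ∑ i : Fin L, (2 ^ (i : ℕ) : ℤ) • psi (c i)

/-- The carries produced by adding two words, moved up by one level; the carry out of the
top level is dropped. -/
def carry {n M : ℕ} (a d : Fin (M + 1) → Fin n → ZMod 2) : Fin (M + 1) → Fin n → ZMod 2 :=
  Fin.cons 0 fun i : Fin M => a i.castSucc * d i.castSucc

theorem levelSum_add {n M : ℕ} (a d : Fin (M + 1) → Fin n → ZMod 2) :
    levelSum a + levelSum d = levelSum (a + d) + levelSum (carry a d) +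
      (2 ^ (M + 1) : ℤ) • psi (a (Fin.last M) * d (Fin.last M)) := by
  have hcarry : levelSum (carry a d) +
      (2 ^ (M + 1) : ℤ) • psi (a (Fin.last M) * d (Fin.last M)) =
      ∑ i : Fin (M + 1), (2 ^ ((i : ℕ) + 1) : ℤ) • psi (a i * d i) := by
    rw [Fin.sum_univ_castSucc, levelSum, Fin.sum_univ_succ]
    simp [carry, psi_zero]
  rw [add_assoc, hcarry, levelSum, levelSum, levelSum, ← sum_add_distrib, ← sum_add_distrib]
  refine sum_congr rfl fun i _ => ?_
  rw [← smul_add, psi_add, smul_add, smul_smul, pow_succ, Pi.add_apply]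

theorem carry_mem {n M : ℕ} (C : Submodule (ZMod 2) (Fin (M + 1) → Fin n → ZMod 2))
    (hschur : ∀ i j : Fin (M + 1), (j : ℕ) + 1 = (i : ℕ) →
      ∀ c ∈ Proj (C : Set (Fin (M + 1) → Fin n → ZMod 2)) j,
      ∀ c' ∈ Proj (C : Set (Fin (M + 1) → Fin n → ZMod 2)) j,
        c * c' ∈ Anti (C : Set (Fin (M + 1) → Fin n → ZMod 2)) i)
    {a d : Fin (M + 1) → Fin n → ZMod 2} (ha : a ∈ C) (hd : d ∈ C) : carry a d ∈ C := by
  have hsum : carry a d = ∑ i : Fin (M + 1), fun j => if j = i then carry a d i else 0 := by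
    funext j
    simp [Finset.sum_apply]
  rw [hsum]
  refine C.sum_mem fun i _ => ?_
  cases i using Fin.cases with
  | zero =>
    convert C.zero_mem using 1
    funext j
    simp [carry]
  | succ i =>
    exact hschur i.succ i.castSucc (by simp) _ ⟨a, ha, rfl⟩ _ ⟨d, hd, rfl⟩

theorem levelSum_add_mem_GammaL {n M : ℕ}
    (C : Submodule (ZMod 2) (Fin (M + 1) → Fin n → ZMod 2))
    (hschur : ∀ i j : Fin (M + 1), (j : ℕ) + 1 = (i : ℕ) →
      ∀ c ∈ Proj (C : Set (Fin (M + 1) → Fin n → ZMod 2)) j,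
      ∀ c' ∈ Proj (C : Set (Fin (M + 1) → Fin n → ZMod 2)) j,
        c * c' ∈ Anti (C : Set (Fin (M + 1) → Fin n → ZMod 2)) i)
    (k m : ℕ) (hkm : M + 1 ≤ k + m) {a d : Fin (M + 1) → Fin n → ZMod 2}
    (ha : a ∈ C) (hd : d ∈ C) (hzero : ∀ i : Fin (M + 1), (i : ℕ) < k → d i = 0) :
    levelSum a + levelSum d ∈ GammaL (C : Set (Fin (M + 1) → Fin n → ZMod 2)) := by
  induction m generalizing k a d with
  | zero =>
    have hd0 : levelSum d = 0 := by
      refine sum_eq_zero fun i _ => ?_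
      rw [hzero i (by omega), psi_zero, smul_zero]
    exact ⟨a, ha, 0, by rw [hd0, smul_zero]; rfl⟩
  | succ m ih =>
    obtain ⟨c, hc, z, hz⟩ := ih (k + 1) (by omega) (C.add_mem ha hd)
      (carry_mem C hschur ha hd) fun i hi => by
        cases i using Fin.cases with
        | zero => simp [carry]
        | succ i =>
          have := hzero i.castSucc (by simpa using hi)
          simp [carry, this]
    refine ⟨c, hc, z + psi (a (Fin.last M) * d (Fin.last M)), ?_⟩
    rw [levelSum_add, hz, smul_add, add_assoc]

theorem GammaL_add_mem {n M : ℕ}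
    (C : Submodule (ZMod 2) (Fin (M + 1) → Fin n → ZMod 2))
    (hschur : ∀ i j : Fin (M + 1), (j : ℕ) + 1 = (i : ℕ) →
      ∀ c ∈ Proj (C : Set (Fin (M + 1) → Fin n → ZMod 2)) j,
      ∀ c' ∈ Proj (C : Set (Fin (M + 1) → Fin n → ZMod 2)) j,
        c * c' ∈ Anti (C : Set (Fin (M + 1) → Fin n → ZMod 2)) i)
    {v w : Fin n → ℤ} (hv : v ∈ GammaL (C : Set (Fin (M + 1) → Fin n → ZMod 2)))
    (hw : w ∈ GammaL (C : Set (Fin (M + 1) → Fin n → ZMod 2))) :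
    v + w ∈ GammaL (C : Set (Fin (M + 1) → Fin n → ZMod 2)) := by
  obtain ⟨a, ha, y, rfl⟩ := hv
  obtain ⟨d, hd, z, rfl⟩ := hw
  obtain ⟨c, hc, x, hx⟩ :=
    levelSum_add_mem_GammaL C hschur 0 (M + 1) (by omega) ha hd fun i hi => by omega
  refine ⟨c, hc, x + (y + z), ?_⟩
  rw [add_add_add_comm, ← smul_add, smul_add _ x, ← add_assoc, ← hx]
  rfl

theorem smul_mem_GammaL {n L : ℕ} (C : Submodule (ZMod 2) (Fin L → Fin n → ZMod 2))
    (z : Fin n → ℤ) : (2 ^ L : ℤ) • z ∈ GammaL (C : Set (Fin L → Fin n → ZMod 2)) :=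
  ⟨0, C.zero_mem, z, by simp [psi_zero]⟩

/-- A set of integer vectors that is closed under addition and contains `N ℤ^n`, with `N`
a power of two, is closed under negation. -/
theorem neg_mem_of_add_mem {n L : ℕ} {S : Set (Fin n → ℤ)}
    (hadd : ∀ v ∈ S, ∀ w ∈ S, v + w ∈ S) (hsmul : ∀ z, (2 ^ L : ℤ) • z ∈ S)
    {v : Fin n → ℤ} (hv : v ∈ S) : -v ∈ S := by
  have hmul : ∀ m : ℕ, (m : ℤ) • v ∈ S := by
    intro m
    induction m with
    | zero => simpa using hsmul 0
    | succ m ih => simpa [add_smul] using hadd _ ih _ hv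
  have h := hadd _ (hmul (2 ^ L - 1)) _ (hsmul (-v))
  convert h using 1
  rw [Nat.cast_sub Nat.one_le_two_pow, sub_smul]
  push_cast
  module

/-- if `C_1 ⊆ S_2 ⊆ C_2 ⊆ S_3 ⊆ ⋯ ⊆ C_{L-1} ⊆ S_L ⊆ C_L` and each nesting
`C_{i-1} ⊆ S_i` is closed under the Schur product, then Construction C* yields an additive
subgroup of `ℝ^n`, hence a lattice. -/
theorem constructionCstar_multilevel_isLattice (n L : ℕ) (hn : 1 ≤ n) (hL : 2 ≤ L)
    (C : Submodule (ZMod 2) (Fin L → Fin n → ZMod 2))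
    (hchain : ∀ i j : Fin L, (j : ℕ) + 1 = (i : ℕ) →
      Proj (C : Set (Fin L → Fin n → ZMod 2)) j ⊆ Anti (C : Set (Fin L → Fin n → ZMod 2)) i ∧
      Anti (C : Set (Fin L → Fin n → ZMod 2)) i ⊆ Proj (C : Set (Fin L → Fin n → ZMod 2)) i)
    (hschur : ∀ i j : Fin L, (j : ℕ) + 1 = (i : ℕ) →
      ∀ c ∈ Proj (C : Set (Fin L → Fin n → ZMod 2)) j,
      ∀ c' ∈ Proj (C : Set (Fin L → Fin n → ZMod 2)) j,
        c * c' ∈ Anti (C : Set (Fin L → Fin n → ZMod 2)) i) :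
    ∃ H : AddSubgroup (Fin n → ℝ),
      toReal '' GammaL (C : Set (Fin L → Fin n → ZMod 2)) = ↑H := by
  obtain ⟨M, rfl⟩ : ∃ M, L = M + 1 := ⟨L - 1, by omega⟩
  have hadd := fun v hv w hw => GammaL_add_mem C hschur (v := v) (w := w) hv hw
  refine ⟨{ carrier := toReal '' GammaL (C : Set (Fin (M + 1) → Fin n → ZMod 2))
            zero_mem' := ⟨0, by simpa using smul_mem_GammaL C 0, by funext i; simp [toReal]⟩
            add_mem' := ?_
            neg_mem' := ?_ }, rfl⟩
  · rintro _ _ ⟨v, hv, rfl⟩ ⟨w, hw, rfl⟩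
    exact ⟨v + w, hadd v hv w hw, by funext i; simp [toReal]⟩
  · rintro _ ⟨v, hv, rfl⟩
    exact ⟨-v, neg_mem_of_add_mem hadd (smul_mem_GammaL C) hv, by funext i; simp [toReal]⟩
end

section
/- Let n ≥ 2 and let C2 ⊆ F_2^n be any linear binary code, and let Γ ⊆ ℤ^n be the Construction C* constellation built from the 3-level code C determined by C2. Then there exist two distinct points of Γ whose squared Euclidean distance is 32; in particular, the minimum squared Euclidean distance between distinct points of Γ is at most 32, independently of n. -/
open Finset

/-- The Hamming weight of a binary vector. -/
def wt {n : ℕ} (x : Fin n → ZMod 2) : ℕ := (Finset.univ.filter fun i => x i ≠ 0).card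

/-- Membership in the 3-level code `C ⊆ F_2^{3n}` determined by `C2`:
`(c1,c2,c3) ∈ C` iff `c2 ∈ C2` and either `c1 = (0,…,0)` with `c3` of even Hamming
weight, or `c1 = (1,…,1)` with `c3` of odd Hamming weight. -/
def inCode {n : ℕ} (C2 : Set (Fin n → ZMod 2)) (c1 c2 c3 : Fin n → ZMod 2) : Prop :=
  c2 ∈ C2 ∧ ((c1 = 0 ∧ Even (wt c3)) ∨ (c1 = 1 ∧ ¬ Even (wt c3)))

/-- The Construction C* constellation `Γ = {c1 + 2 c2 + 4 c3 + 8 z : (c1,c2,c3) ∈ C, z ∈ ℤ^n}`. -/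
def Gamma {n : ℕ} (C2 : Set (Fin n → ZMod 2)) : Set (Fin n → ℤ) :=
  { v | ∃ c1 c2 c3 : Fin n → ZMod 2, ∃ z : Fin n → ℤ,
      inCode C2 c1 c2 c3 ∧ v = psi c1 + 2 • psi c2 + 4 • psi c3 + 8 • z }

/-- A binary code is self-orthogonal if `⟨c, c'⟩ = 0` for all codewords `c, c'`. -/
def SelfOrthogonal {n : ℕ} (C : Set (Fin n → ZMod 2)) : Prop :=
  ∀ c ∈ C, ∀ c' ∈ C, ∑ i, c i * c' i = 0

theorem zero_mem_Gamma {n : ℕ} (C2 : Submodule (ZMod 2) (Fin n → ZMod 2)) :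
    (0 : Fin n → ℤ) ∈ Gamma (C2 : Set (Fin n → ZMod 2)) := by
  refine ⟨0, 0, 0, 0, ⟨C2.zero_mem, Or.inl ⟨rfl, by simp [wt]⟩⟩, ?_⟩
  ext i
  simp [psi]

theorem four_single_pair_mem_Gamma {n : ℕ} (C2 : Submodule (ZMod 2) (Fin n → ZMod 2))
    {a b : Fin n} (hab : a ≠ b) :
    (fun i => if i ∈ ({a, b} : Finset (Fin n)) then (4 : ℤ) else 0) ∈
      Gamma (C2 : Set (Fin n → ZMod 2)) := by
  refine ⟨0, 0, fun i => if i ∈ ({a, b} : Finset (Fin n)) then 1 else 0, 0,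
    ⟨C2.zero_mem, Or.inl ⟨rfl, ?_⟩⟩, ?_⟩
  · have h : (Finset.univ.filter fun i => (if i ∈ ({a, b} : Finset (Fin n)) then
        (1 : ZMod 2) else 0) ≠ 0) = {a, b} := by
      ext i
      simp only [Finset.mem_filter_univ, ne_eq, ite_eq_right_iff, one_ne_zero, imp_false, not_not]
    rw [wt, h, Finset.card_pair hab]
    exact even_two
  · ext i
    by_cases h : i ∈ ({a, b} : Finset (Fin n)) <;>
      simp only [psi, Pi.add_apply, Pi.smul_apply, Pi.zero_apply, h, if_true, if_false,
        ZMod.val_zero, ZMod.val_one] <;> norm_num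

/-- for `n ≥ 2` and any linear binary code `C2`, the constellation `Γ`
contains two distinct points at squared Euclidean distance `32`; in particular the minimum
squared distance between distinct points of `Γ` is at most `32`, independently of `n`. -/
theorem gamma_dist_sq_32 (n : ℕ) (hn : 2 ≤ n)
    (C2 : Submodule (ZMod 2) (Fin n → ZMod 2)) :
    (∃ x ∈ Gamma (C2 : Set (Fin n → ZMod 2)), ∃ y ∈ Gamma (C2 : Set (Fin n → ZMod 2)),
      x ≠ y ∧ ∑ i, (x i - y i) ^ 2 = (32 : ℤ)) ∧
    (∀ d : ℤ, IsLeast {d' : ℤ | ∃ x ∈ Gamma (C2 : Set (Fin n → ZMod 2)),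
        ∃ y ∈ Gamma (C2 : Set (Fin n → ZMod 2)), x ≠ y ∧ d' = ∑ i, (x i - y i) ^ 2} d →
      d ≤ 32) := by
  have key : ∃ x ∈ Gamma (C2 : Set (Fin n → ZMod 2)), ∃ y ∈ Gamma (C2 : Set (Fin n → ZMod 2)),
      x ≠ y ∧ ∑ i, (x i - y i) ^ 2 = (32 : ℤ) := by
    have hab : (⟨0, by omega⟩ : Fin n) ≠ ⟨1, by omega⟩ := by simp
    refine ⟨_, four_single_pair_mem_Gamma C2 hab, 0, zero_mem_Gamma C2, fun h => ?_, ?_⟩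
    · simpa using congrFun h ⟨0, by omega⟩
    · simp only [Pi.zero_apply, sub_zero, ite_pow, zero_pow two_ne_zero]
      rw [Finset.sum_ite_mem, Finset.univ_inter, Finset.sum_pair hab]
      norm_num
  refine ⟨key, fun d hd => ?_⟩
  obtain ⟨x, hx, y, hy, hxy, h⟩ := key
  exact hd.2 ⟨x, hx, y, hy, hxy, h.symm⟩
end

section
/- Let C2 ⊆ F_2^8 be the [8,4,4] extended Hamming code, namely the linear span of the four vectors (1,1,1,1,1,1,1,1), (0,1,0,1,0,1,0,1), (0,0,1,1,0,0,1,1), (0,0,0,0,1,1,1,1), and let Γ ⊆ ℤ^8 be the Construction C* constellation built from the 3-level code C determined by C2. Then Γ is an additive subgroup of ℤ^8 of index 2^12, and the minimum squared Euclidean norm of a nonzero element of Γ is 16 (so the minimum distance of Γ is 4). Consequently the Hermite invariant d_min^2 / vol^{2/8} of this lattice equals 2, the Hermite constant of the E_8 lattice. -/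
open Finset

/-- Generators of the `[8,4,4]` extended Hamming code. -/
def hammingGens : Set (Fin 8 → ZMod 2) :=
  {![1,1,1,1,1,1,1,1], ![0,1,0,1,0,1,0,1], ![0,0,1,1,0,0,1,1], ![0,0,0,0,1,1,1,1]}

/-- The `[8,4,4]` extended Hamming code: the linear span of the four given vectors. -/
def extendedHamming : Submodule (ZMod 2) (Fin 8 → ZMod 2) :=
  Submodule.span (ZMod 2) hammingGens

lemma psi_apply_eq_zero_or_one {n : ℕ} (x : Fin n → ZMod 2) (i : Fin n) :
    psi x i = 0 ∨ psi x i = 1 := by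
  have := (x i).val_lt
  simp only [psi]
  omega

lemma sum_psi_eq_wt {n : ℕ} (x : Fin n → ZMod 2) : ∑ i, psi x i = wt x := by
  have h : ∀ b : ZMod 2, (b.val : ℤ) = if b ≠ 0 then 1 else 0 := by decide
  simp only [psi, wt, h, Finset.sum_boole]

lemma psi_intCast {n : ℕ} (v : Fin n → ℤ) (i : Fin n) :
    psi (fun j => (v j : ZMod 2)) i = v i % 2 := by
  simp only [psi]
  exact ZMod.val_intCast _

lemma two_dvd_iff_intCast_zmod (a : ℤ) : 2 ∣ a ↔ (a : ZMod 2) = 0 :=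
  (ZMod.intCast_zmod_eq_zero_iff_dvd a 2).symm

lemma intCast_psi {n : ℕ} (x : Fin n → ZMod 2) (i : Fin n) : ((psi x i : ℤ) : ZMod 2) = x i := by
  simp [psi]

/-- The codewords are the evaluations of the affine functions on `F_2^3`. -/
lemma mem_extendedHamming_iff (c : Fin 8 → ZMod 2) :
    c ∈ extendedHamming ↔ ∃ k l m p : ZMod 2,
      c = ![k, k + l, k + m, k + l + m, k + p, k + l + p, k + m + p, k + l + m + p] := by
  simp only [extendedHamming, hammingGens, Submodule.mem_span_insert,
    Submodule.mem_span_singleton]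
  constructor
  · rintro ⟨k, _, ⟨l, _, ⟨m, _, ⟨p, rfl⟩, rfl⟩, rfl⟩, rfl⟩
    refine ⟨k, l, m, p, ?_⟩
    ext i
    fin_cases i <;> simp [add_assoc]
  · rintro ⟨k, l, m, p, rfl⟩
    refine ⟨k, _, ⟨l, _, ⟨m, _, ⟨p, rfl⟩, rfl⟩, rfl⟩, ?_⟩
    ext i
    fin_cases i <;> simp [add_assoc]

/-- The extended Hamming code is doubly even. -/
lemma four_dvd_sum_psi {c : Fin 8 → ZMod 2} (hc : c ∈ extendedHamming) :
    4 ∣ ∑ i, psi c i := by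
  obtain ⟨k, l, m, p, rfl⟩ := (mem_extendedHamming_iff c).1 hc
  clear hc
  simp only [psi]
  revert k l m p
  decide

/-- Parity checks of the extended Hamming code, which is self-dual. -/
lemma mem_extendedHamming_iff_dvd (c : Fin 8 → ZMod 2) :
    c ∈ extendedHamming ↔ 2 ∣ ∑ i, psi c i ∧ 2 ∣ psi c 1 + psi c 3 + psi c 5 + psi c 7 ∧
      2 ∣ psi c 2 + psi c 3 + psi c 6 + psi c 7 ∧
      2 ∣ psi c 4 + psi c 5 + psi c 6 + psi c 7 := by
  simp only [mem_extendedHamming_iff, two_dvd_iff_intCast_zmod, Fin.sum_univ_eight,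
    Int.cast_add, intCast_psi]
  constructor
  · rintro ⟨k, l, m, p, rfl⟩
    revert k l m p
    decide
  · rintro ⟨h₀, h₁, h₂, h₃⟩
    refine ⟨c 0, c 0 + c 1, c 0 + c 2, c 0 + c 4, ?_⟩
    ext i
    fin_cases i <;> simp <;> grind

/-- The syndrome map, whose kernel is the Construction C* lattice of the extended Hamming code. -/
def syndrome : (Fin 8 → ℤ) →+
    ZMod 8 × ZMod 4 × ZMod 4 × ZMod 4 × ZMod 2 × ZMod 2 × ZMod 2 where
  toFun v := ((∑ i, v i - 4 * v 0 : ℤ), (v 1 + v 3 + v 5 + v 7 : ℤ),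
    (v 2 + v 3 + v 6 + v 7 : ℤ), (v 4 + v 5 + v 6 + v 7 : ℤ),
    (v 1 - v 0 : ℤ), (v 2 - v 0 : ℤ), (v 4 - v 0 : ℤ))
  map_zero' := by simp
  map_add' v w := by
    simp only [Prod.mk_add_mk, Prod.mk.injEq, Pi.add_apply, Finset.sum_add_distrib]
    push_cast
    refine ⟨?_, ?_, ?_, ?_, ?_, ?_, ?_⟩ <;> ring

lemma mem_ker_syndrome_iff (v : Fin 8 → ℤ) :
    v ∈ syndrome.ker ↔ 8 ∣ ∑ i, v i - 4 * v 0 ∧ 4 ∣ v 1 + v 3 + v 5 + v 7 ∧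
      4 ∣ v 2 + v 3 + v 6 + v 7 ∧ 4 ∣ v 4 + v 5 + v 6 + v 7 ∧
      2 ∣ v 1 - v 0 ∧ 2 ∣ v 2 - v 0 ∧ 2 ∣ v 4 - v 0 := by
  simp only [AddMonoidHom.mem_ker, syndrome, AddMonoidHom.coe_mk, ZeroHom.coe_mk,
    Prod.mk_eq_zero, ZMod.intCast_zmod_eq_zero_iff_dvd]
  rfl

lemma syndrome_surjective : Function.Surjective syndrome := by
  rintro ⟨e, s₁, s₂, s₃, p, q, r⟩
  obtain ⟨e, rfl⟩ := ZMod.intCast_surjective e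
  obtain ⟨s₁, rfl⟩ := ZMod.intCast_surjective s₁
  obtain ⟨s₂, rfl⟩ := ZMod.intCast_surjective s₂
  obtain ⟨s₃, rfl⟩ := ZMod.intCast_surjective s₃
  obtain ⟨p, rfl⟩ := ZMod.intCast_surjective p
  obtain ⟨q, rfl⟩ := ZMod.intCast_surjective q
  obtain ⟨r, rfl⟩ := ZMod.intCast_surjective r
  refine ⟨![0, p, q, e - s₃ - p - q, r, e - s₂ - p - r, e - s₁ - q - r,
    -2 * e + s₁ + s₂ + s₃ + p + q + r], ?_⟩
  simp only [syndrome, AddMonoidHom.coe_mk, ZeroHom.coe_mk, Fin.sum_univ_eight, Prod.mk.injEq]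
  refine ⟨?_, ?_, ?_, ?_, ?_, ?_, ?_⟩ <;> congr 1 <;> simp <;> ring

lemma index_ker_syndrome : syndrome.ker.index = 2 ^ 12 := by
  rw [AddSubgroup.index_ker, AddMonoidHom.range_eq_top.2 syndrome_surjective]
  simp

/-- Parametrization of `Γ` in terms of the common parity `ε` of the coordinates. -/
lemma mem_Gamma_iff {n : ℕ} (C2 : Set (Fin n → ZMod 2)) (v : Fin n → ℤ) :
    v ∈ Gamma C2 ↔ ∃ (ε : ℤ) (a x : Fin n → ZMod 2) (z : Fin n → ℤ), a ∈ C2 ∧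
      (ε = 0 ∨ ε = 1) ∧ 2 ∣ ∑ i, psi x i - ε ∧
      ∀ i, v i = ε + 2 * psi a i + 4 * psi x i + 8 * z i := by
  simp only [sum_psi_eq_wt]
  constructor
  · rintro ⟨c, a, x, z, ⟨ha, ⟨rfl, hx⟩ | ⟨rfl, hx⟩⟩, rfl⟩
    · exact ⟨0, a, x, z, ha, .inl rfl, by grind, fun i => by simp [psi]⟩
    · exact ⟨1, a, x, z, ha, .inr rfl, by grind, fun i => by simp [psi, ZMod.val_one]⟩
  · rintro ⟨_, a, x, z, ha, rfl | rfl, hx, hv⟩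
    · exact ⟨0, a, x, z, ⟨ha, .inl ⟨rfl, by grind⟩⟩, by ext i; simp [hv, psi]⟩
    · exact ⟨1, a, x, z, ⟨ha, .inr ⟨rfl, by grind⟩⟩, by ext i; simp [hv, psi, ZMod.val_one]⟩

lemma Gamma_extendedHamming_eq_ker :
    Gamma (extendedHamming : Set (Fin 8 → ZMod 2)) = syndrome.ker := by
  ext v
  rw [SetLike.mem_coe, mem_ker_syndrome_iff, mem_Gamma_iff]
  constructor
  · rintro ⟨ε, a, x, z, ha, hε, hx, hv⟩
    have h4 := four_dvd_sum_psi ha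
    obtain ⟨-, h₁, h₂, h₃⟩ := (mem_extendedHamming_iff_dvd a).1 ha
    simp only [Fin.sum_univ_eight, hv] at *
    omega
  · rintro ⟨h₀, h₁, h₂, h₃, h₄, h₅, h₆⟩
    have hpar : ∀ i, v i % 2 = v 0 % 2 := by
      rw [Fin.sum_univ_eight] at h₀
      intro i
      fin_cases i <;> simp <;> omega
    have ha : (fun i => ((v i / 2 : ℤ) : ZMod 2)) ∈ extendedHamming := by
      rw [mem_extendedHamming_iff_dvd]
      rw [Fin.sum_univ_eight] at h₀
      simp only [Fin.sum_univ_eight, psi_intCast]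
      have := hpar 1; have := hpar 2; have := hpar 3; have := hpar 4
      have := hpar 5; have := hpar 6; have := hpar 7
      omega
    have h4 := four_dvd_sum_psi ha
    have hv : ∀ i, v i = v 0 % 2 + 2 * psi (fun i => ((v i / 2 : ℤ) : ZMod 2)) i +
        4 * psi (fun i => ((v i / 4 : ℤ) : ZMod 2)) i + 8 * (v i / 8) := by
      intro i
      have := hpar i
      simp only [psi_intCast]
      omega
    refine ⟨v 0 % 2, _, fun i => ((v i / 4 : ℤ) : ZMod 2), fun i => v i / 8, ha,
      by omega, ?_, hv⟩
    have hsum : ∑ i, v i = _ := Finset.sum_congr rfl fun i _ => hv i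
    simp only [Finset.sum_add_distrib, ← Finset.mul_sum, Finset.sum_const, Finset.card_univ,
      Fintype.card_fin, nsmul_eq_mul, Nat.cast_ofNat] at hsum
    omega

lemma sq_modEq_sixteen {ε a x : ℤ} (hε : ε = 0 ∨ ε = 1) (ha : a = 0 ∨ a = 1)
    (hx : x = 0 ∨ x = 1) (z : ℤ) :
    (ε + 2 * a + 4 * x + 8 * z) ^ 2 ≡ ε + 4 * (1 + ε) * a + 8 * ε * x [ZMOD 16] := by
  apply Int.ModEq.symm
  rw [Int.modEq_iff_dvd]
  rcases hε with rfl | rfl <;> rcases ha with rfl | rfl <;> rcases hx with rfl | rfl <;>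
    ring_nf <;> omega

lemma sixteen_dvd_sum_sq {v : Fin 8 → ℤ}
    (hv : v ∈ Gamma (extendedHamming : Set (Fin 8 → ZMod 2))) : 16 ∣ ∑ i, v i ^ 2 := by
  obtain ⟨ε, a, x, z, ha, hε, hx, hv⟩ := (mem_Gamma_iff _ v).1 hv
  have h4 := four_dvd_sum_psi ha
  have hsum : ∑ i, v i ^ 2 ≡ ∑ i, (ε + 4 * (1 + ε) * psi a i + 8 * ε * psi x i) [ZMOD 16] :=
    Int.ModEq.sum fun i _ => hv i ▸
      sq_modEq_sixteen hε (psi_apply_eq_zero_or_one a i) (psi_apply_eq_zero_or_one x i) (z i)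
  rw [Finset.sum_add_distrib, Finset.sum_add_distrib, ← Finset.mul_sum, ← Finset.mul_sum] at hsum
  refine (Int.ModEq.dvd_iff hsum).2 ?_
  rcases hε with rfl | rfl <;> simp <;> omega

lemma isLeast_sum_sq_Gamma_extendedHamming :
    IsLeast {m : ℤ | ∃ v ∈ Gamma (extendedHamming : Set (Fin 8 → ZMod 2)),
      v ≠ 0 ∧ m = ∑ i, (v i) ^ 2} 16 := by
  constructor
  · refine ⟨![0, 0, 0, 0, 2, 2, 2, 2], ?_, ?_, by simp [Fin.sum_univ_eight]⟩
    · rw [Gamma_extendedHamming_eq_ker, SetLike.mem_coe, mem_ker_syndrome_iff]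
      simp [Fin.sum_univ_eight]
    · exact fun h => by simpa using congrFun h 4
  · rintro _ ⟨v, hv, hne, rfl⟩
    obtain ⟨i, hi⟩ := Function.ne_iff.1 hne
    exact Int.le_of_dvd (Finset.sum_pos' (fun j _ => sq_nonneg _)
      ⟨i, Finset.mem_univ i, by simpa using sq_pos_of_ne_zero hi⟩) (sixteen_dvd_sum_sq hv)

/-- with `C2` the `[8,4,4]` extended Hamming code, `Γ` is an additive
subgroup of `ℤ^8` of index `2^12`, its minimum squared norm of a nonzero point is `16`
(minimum distance `4`), and its Hermite invariant `d_min^2 / vol^{2/8}` equals `2`,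
the Hermite constant of the `E_8` lattice. -/
theorem constructionCstar_E8 :
    ∃ H : AddSubgroup (Fin 8 → ℤ),
      Gamma (extendedHamming : Set (Fin 8 → ZMod 2)) = ↑H ∧
      H.index = 2 ^ 12 ∧
      IsLeast {m : ℤ | ∃ v ∈ Gamma (extendedHamming : Set (Fin 8 → ZMod 2)),
        v ≠ 0 ∧ m = ∑ i, (v i) ^ 2} 16 ∧
      (16 : ℝ) / ((H.index : ℝ) ^ ((2 : ℝ) / 8)) = 2 := by
  refine ⟨syndrome.ker, Gamma_extendedHamming_eq_ker, index_ker_syndrome,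
    isLeast_sum_sq_Gamma_extendedHamming, ?_⟩
  rw [index_ker_syndrome, Nat.cast_pow, ← Real.rpow_natCast, ← Real.rpow_mul (by norm_num)]
  norm_num
end

section
/- Let C2 ⊆ F_2^{14} be any self-dual linear binary code of length 14 whose minimum Hamming weight is 4 (a [14,7,4] self-dual code), and let Γ ⊆ ℤ^{14} be the Construction C* constellation built from the 3-level code C determined by C2. Then Γ is an additive subgroup of ℤ^{14} of index 2^21, and the minimum squared Euclidean norm of a nonzero element of Γ is 16. Consequently the Hermite invariant d_min^2 / vol^{2/14} of this lattice equals 2. -/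
open Finset

/-- The dual of a binary code `C ⊆ F_2^n`. -/
def dualCode {n : ℕ} (C : Set (Fin n → ZMod 2)) : Set (Fin n → ZMod 2) :=
  { x | ∀ c ∈ C, ∑ i, x i * c i = 0 }

open Module

/-- Coordinatewise reduction modulo 2. -/
def red (n : ℕ) : (Fin n → ℤ) →+ (Fin n → ZMod 2) :=
  (Int.castAddHom (ZMod 2)).compLeft (Fin n)

@[simp]
theorem red_apply {n : ℕ} (w : Fin n → ℤ) (i : Fin n) : red n w i = (w i : ZMod 2) := rfl

theorem red_surjective (n : ℕ) : Function.Surjective (red n) := fun c =>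
  ⟨psi c, by ext i; simp [psi]⟩

theorem psi_red {n : ℕ} (w : Fin n → ℤ) (i : Fin n) : psi (red n w) i = w i % 2 := by
  simpa [psi] using ZMod.val_intCast (n := 2) (w i)

theorem psi_eq_zero_or_one {n : ℕ} (c : Fin n → ZMod 2) (i : Fin n) :
    psi c i = 0 ∨ psi c i = 1 := by
  have := ZMod.val_lt (c i)
  simp only [psi]
  omega

theorem wt_eq_sum_psi {n : ℕ} (c : Fin n → ZMod 2) : (wt c : ℤ) = ∑ i, psi c i := by
  rw [wt, card_filter, Nat.cast_sum]
  refine sum_congr rfl fun i _ => ?_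
  simp only [psi]
  generalize c i = a
  fin_cases a <;> rfl

/-- The integer-valued quadratic function `w ↦ ∑ i, w i * (w i - 1)`. -/
def quad {n : ℕ} (w : Fin n → ℤ) : ℤ := ∑ i, w i * (w i - 1)

theorem quad_add {n : ℕ} (v w : Fin n → ℤ) :
    quad (v + w) = quad v + quad w + 2 * ∑ i, v i * w i := by
  simp only [quad, mul_sum, ← sum_add_distrib, Pi.add_apply]
  exact sum_congr rfl fun i _ => by ring

theorem quad_neg {n : ℕ} (w : Fin n → ℤ) : quad (-w) = quad w + 2 * ∑ i, w i := by
  simp only [quad, mul_sum, ← sum_add_distrib, Pi.neg_apply]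
  exact sum_congr rfl fun i _ => by ring

theorem quad_one {n : ℕ} : quad (1 : Fin n → ℤ) = 0 := by simp [quad]

theorem quad_single {n : ℕ} (i : Fin n) : quad (Pi.single i 2) = 2 := by
  rw [quad, sum_eq_single i]
  · simp
  · intro j _ hj
    simp [hj]
  · simp

theorem even_quad {n : ℕ} (w : Fin n → ℤ) : 2 ∣ quad w :=
  dvd_sum fun i _ => (Int.even_mul_pred_self (w i)).two_dvd

theorem red_single_two {n : ℕ} (i : Fin n) : red n (Pi.single i 2) = 0 := by
  ext j
  rcases eq_or_ne j i with rfl | h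
  · simp; rfl
  · simp [h]

theorem sum_sq_two_mul {n : ℕ} (w : Fin n → ℤ) :
    ∑ i, (2 * w i) ^ 2 = 4 * ∑ i, w i ^ 2 := by
  rw [mul_sum]
  exact sum_congr rfl fun i _ => by ring

theorem sum_sq_two_mul_add_one {n : ℕ} (w : Fin n → ℤ) :
    ∑ i, (2 * w i + 1) ^ 2 = 4 * quad w + 8 * ∑ i, w i + n := by
  have : (n : ℤ) = ∑ _i : Fin n, (1 : ℤ) := by simp
  rw [this, quad, mul_sum, mul_sum, ← sum_add_distrib, ← sum_add_distrib]
  exact sum_congr rfl fun i _ => by ring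

/-- A level expansion `a + 2 b + 4 z` satisfies `quad ≡ 2 wt b` modulo 4. -/
theorem four_dvd_quad_sub {n : ℕ} (c2 c3 : Fin n → ZMod 2) (z : Fin n → ℤ) :
    4 ∣ quad (psi c2 + 2 • psi c3 + 4 • z) - 2 * (wt c3 : ℤ) := by
  rw [wt_eq_sum_psi, quad, mul_sum, ← sum_sub_distrib]
  refine dvd_sum fun i _ => ?_
  simp only [Pi.add_apply, nsmul_eq_mul, Nat.cast_ofNat, Pi.mul_apply, Pi.ofNat_apply]
  rcases psi_eq_zero_or_one c2 i with h | h <;> rcases psi_eq_zero_or_one c3 i with h' | h' <;>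
    rw [h, h']
  · exact ⟨z i * (4 * z i - 1), by ring⟩
  · exact ⟨4 * z i ^ 2 + 3 * z i, by ring⟩
  · exact ⟨z i * (4 * z i + 1), by ring⟩
  · exact ⟨4 * z i ^ 2 + 5 * z i + 1, by ring⟩

theorem red_expansion {n : ℕ} (c2 c3 : Fin n → ZMod 2) (z : Fin n → ℤ) :
    red n (psi c2 + 2 • psi c3 + 4 • z) = c2 := by
  ext i
  have h4 : (4 : ZMod 2) = 0 := rfl
  have h2 : (2 : ZMod 2) = 0 := rfl
  simp [psi, h4, h2]

theorem exists_expansion {n : ℕ} (w : Fin n → ℤ) :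
    ∃ (c3 : Fin n → ZMod 2) (z : Fin n → ℤ), w = psi (red n w) + 2 • psi c3 + 4 • z := by
  refine ⟨red n fun i => w i / 2, fun i => w i / 4, funext fun i => ?_⟩
  simp only [Pi.add_apply, nsmul_eq_mul, Nat.cast_ofNat, Pi.mul_apply, Pi.ofNat_apply, psi_red]
  omega

theorem mem_Gamma_iff_s12 {n : ℕ} (C : Set (Fin n → ZMod 2)) (v : Fin n → ℤ) :
    v ∈ Gamma C ↔ (∃ w, v = 2 • w ∧ red n w ∈ C ∧ 4 ∣ quad w) ∨
      ∃ w, v = 2 • w + 1 ∧ red n w ∈ C ∧ 4 ∣ quad w + 2 := by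
  constructor
  · rintro ⟨c1, c2, c3, z, ⟨hc, ⟨rfl, h⟩ | ⟨rfl, h⟩⟩, rfl⟩
    · refine Or.inl ⟨psi c2 + 2 • psi c3 + 4 • z, ?_, by rwa [red_expansion], ?_⟩
      · ext i
        simp [psi]
        ring
      · have := four_dvd_quad_sub c2 c3 z
        obtain ⟨k, hk⟩ := h
        omega
    · refine Or.inr ⟨psi c2 + 2 • psi c3 + 4 • z, ?_, by rwa [red_expansion], ?_⟩
      · ext i
        simp [psi, ZMod.val_one]
        ring
      · have := four_dvd_quad_sub c2 c3 z
        obtain ⟨k, hk⟩ := Nat.not_even_iff_odd.1 h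
        omega
  · rintro (⟨w, rfl, hc, h⟩ | ⟨w, rfl, hc, h⟩)
    · obtain ⟨c3, z, hw⟩ := exists_expansion w
      have := four_dvd_quad_sub (red n w) c3 z
      rw [← hw] at this
      refine ⟨0, red n w, c3, z, ⟨hc, Or.inl ⟨rfl, Nat.even_iff.2 (by omega)⟩⟩, ?_⟩
      ext i
      have := congrFun hw i
      simp only [Pi.add_apply, nsmul_eq_mul, Nat.cast_ofNat, Pi.mul_apply,
        Pi.ofNat_apply] at this ⊢
      have h0 : psi (0 : Fin n → ZMod 2) i = 0 := by simp [psi]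
      omega
    · obtain ⟨c3, z, hw⟩ := exists_expansion w
      have := four_dvd_quad_sub (red n w) c3 z
      rw [← hw] at this
      refine ⟨1, red n w, c3, z, ⟨hc, Or.inr ⟨rfl, ?_⟩⟩, ?_⟩
      · rw [Nat.even_iff]
        omega
      ext i
      have := congrFun hw i
      simp only [Pi.add_apply, nsmul_eq_mul, Nat.cast_ofNat, Pi.mul_apply,
        Pi.ofNat_apply] at this ⊢
      have h1 : psi (1 : Fin n → ZMod 2) i = 1 := by simp [psi, ZMod.val_one]
      omega

section SelfDual

variable {n : ℕ} {C : Submodule (ZMod 2) (Fin n → ZMod 2)}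

theorem one_mem_of_selfDual (hC : (C : Set (Fin n → ZMod 2)) = dualCode C) : 1 ∈ C := by
  rw [← SetLike.mem_coe, hC]
  intro c hc
  have h : ∑ i, c i * c i = 0 := by
    have hc' := hc
    rw [hC] at hc'
    exact hc' c hc
  rw [← h]
  refine sum_congr rfl fun i _ => ?_
  rw [Pi.one_apply, one_mul]
  generalize c i = a
  fin_cases a <;> rfl

theorem two_dvd_sum_mul (hC : (C : Set (Fin n → ZMod 2)) = dualCode C) {v w : Fin n → ℤ}
    (hv : red n v ∈ C) (hw : red n w ∈ C) : 2 ∣ ∑ i, v i * w i := by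
  rw [← SetLike.mem_coe, hC] at hv
  have h := hv _ hw
  simp only [red_apply] at h
  exact_mod_cast (ZMod.intCast_zmod_eq_zero_iff_dvd (∑ i, v i * w i) 2).1 (by push_cast; exact h)

theorem red_one : red n 1 = 1 := by
  ext i
  simp

theorem two_dvd_sum (hC : (C : Set (Fin n → ZMod 2)) = dualCode C) {w : Fin n → ℤ}
    (hw : red n w ∈ C) : 2 ∣ ∑ i, w i := by
  have h : red n 1 ∈ C := red_one ▸ one_mem_of_selfDual hC
  simpa using two_dvd_sum_mul hC hw h

/-- The integer vectors reducing into `C` on which `quad` vanishes modulo 4; twice this subgroup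
is the even part of the Construction C* constellation. -/
def evenHalf (hC : (C : Set (Fin n → ZMod 2)) = dualCode C) : AddSubgroup (Fin n → ℤ) where
  carrier := {w | red n w ∈ C ∧ 4 ∣ quad w}
  zero_mem' := ⟨by simp, by simp [quad]⟩
  add_mem' := by
    rintro v w ⟨hv, qv⟩ ⟨hw, qw⟩
    refine ⟨by rw [map_add]; exact add_mem hv hw, ?_⟩
    have := two_dvd_sum_mul hC hv hw
    rw [quad_add]
    omega
  neg_mem' := by
    rintro w ⟨hw, qw⟩
    refine ⟨by rw [map_neg]; exact neg_mem hw, ?_⟩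
    have := two_dvd_sum hC hw
    rw [quad_neg]
    omega

theorem add_mem_Gamma (hC : (C : Set (Fin n → ZMod 2)) = dualCode C) {u v : Fin n → ℤ}
    (hu : u ∈ Gamma (C : Set (Fin n → ZMod 2))) (hv : v ∈ Gamma (C : Set (Fin n → ZMod 2))) :
    u + v ∈ Gamma (C : Set (Fin n → ZMod 2)) := by
  rw [mem_Gamma_iff_s12] at *
  rcases hu with ⟨x, rfl, hx, qx⟩ | ⟨x, rfl, hx, qx⟩ <;>
    rcases hv with ⟨y, rfl, hy, qy⟩ | ⟨y, rfl, hy, qy⟩ <;>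
    have hxy : red n (x + y) ∈ C := by { rw [map_add]; exact add_mem hx hy } <;>
    have h := two_dvd_sum_mul hC hx hy
  · exact Or.inl ⟨x + y, by rw [smul_add], hxy, by rw [quad_add]; omega⟩
  · exact Or.inr ⟨x + y, by rw [smul_add, add_assoc], hxy, by rw [quad_add]; omega⟩
  · exact Or.inr ⟨x + y, by rw [smul_add, add_right_comm], hxy, by rw [quad_add]; omega⟩
  · have h1 : red n 1 ∈ C := red_one ▸ one_mem_of_selfDual hC
    have := two_dvd_sum_mul hC hxy h1
    refine Or.inl ⟨x + y + 1, ?_, by rw [map_add]; exact add_mem hxy h1, ?_⟩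
    · rw [smul_add, smul_add, two_nsmul (1 : Fin n → ℤ)]
      abel
    · rw [quad_add, quad_add, quad_one]
      omega

theorem neg_mem_Gamma (hC : (C : Set (Fin n → ZMod 2)) = dualCode C) {v : Fin n → ℤ}
    (hv : v ∈ Gamma (C : Set (Fin n → ZMod 2))) : -v ∈ Gamma (C : Set (Fin n → ZMod 2)) := by
  rw [mem_Gamma_iff_s12] at *
  rcases hv with ⟨w, rfl, hw, qw⟩ | ⟨w, rfl, hw, qw⟩
  · exact Or.inl ⟨-w, by rw [smul_neg], (evenHalf hC).neg_mem ⟨hw, qw⟩⟩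
  · have h1 : red n 1 ∈ C := red_one ▸ one_mem_of_selfDual hC
    have hw1 : red n (w + 1) ∈ C := by rw [map_add]; exact add_mem hw h1
    refine Or.inr ⟨-(w + 1), ?_, by rw [map_neg]; exact neg_mem hw1, ?_⟩
    · rw [smul_neg, smul_add, two_nsmul (1 : Fin n → ℤ)]
      abel
    · have := two_dvd_sum hC hw1
      have h := two_dvd_sum_mul hC hw h1
      rw [quad_neg, quad_add, quad_one]
      omega

/-- The Construction C* constellation of a self-dual code, as a subgroup of `ℤ^n`. -/
def gammaSubgroup (hC : (C : Set (Fin n → ZMod 2)) = dualCode C) :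
    AddSubgroup (Fin n → ℤ) where
  carrier := Gamma (C : Set (Fin n → ZMod 2))
  zero_mem' := (mem_Gamma_iff_s12 _ _).2 <| Or.inl ⟨0, by simp, by simp, by simp [quad]⟩
  add_mem' := add_mem_Gamma hC
  neg_mem' := neg_mem_Gamma hC

theorem finrank_of_selfDual (hC : (C : Set (Fin n → ZMod 2)) = dualCode C) :
    2 * finrank (ZMod 2) C = n := by
  set B := Matrix.toBilin' (1 : Matrix (Fin n) (Fin n) (ZMod 2))
  have hB : B.Nondegenerate :=
    LinearMap.BilinForm.nondegenerate_toBilin'_of_det_ne_zero' _ (by simp)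
  have hCB : B.orthogonal C = C := by
    apply SetLike.coe_injective
    conv_rhs => rw [hC]
    ext x
    simp only [SetLike.mem_coe, LinearMap.BilinForm.mem_orthogonal_iff, dualCode,
      Set.mem_ofPred_eq, B, Matrix.toBilin'_apply', Matrix.one_mulVec,
      dotProduct]
    simp only [mul_comm]
  have h := LinearMap.BilinForm.finrank_orthogonal hB C
  rw [hCB, finrank_fin_fun] at h
  have := Submodule.finrank_le C
  rw [finrank_fin_fun] at this
  omega

theorem index_of_selfDual (hC : (C : Set (Fin n → ZMod 2)) = dualCode C) :
    C.toAddSubgroup.index = 2 ^ finrank (ZMod 2) C := by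
  have hcard : Nat.card C.toAddSubgroup = 2 ^ finrank (ZMod 2) C := by
    have h : Nat.card C = 2 ^ finrank (ZMod 2) C := by
      rw [Module.natCard_eq_pow_finrank (K := ZMod 2), Nat.card_zmod]
    exact h
  have h := C.toAddSubgroup.card_mul_index
  rw [hcard, Nat.card_fun, Nat.card_zmod, Nat.card_fin] at h
  have hn : 2 ^ n = 2 ^ finrank (ZMod 2) C * 2 ^ finrank (ZMod 2) C := by
    rw [← pow_add, ← two_mul, finrank_of_selfDual hC]
  rw [hn] at h
  exact Nat.eq_of_mul_eq_mul_left (by positivity) h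

theorem index_evenHalf (hC : (C : Set (Fin n → ZMod 2)) = dualCode C) (hn : 0 < n) :
    (evenHalf hC).index = 2 * 2 ^ finrank (ZMod 2) C := by
  have hle : evenHalf hC ≤ C.toAddSubgroup.comap (red n) := fun w hw => hw.1
  rw [← AddSubgroup.relIndex_mul_index hle,
    AddSubgroup.index_comap_of_surjective _ (red_surjective n), index_of_selfDual hC]
  congr 1
  have ha : red n (Pi.single ⟨0, hn⟩ 2) ∈ C := by rw [red_single_two]; exact zero_mem C
  refine AddSubgroup.relIndex_eq_two_iff_exists_notMem_and.2 ⟨Pi.single ⟨0, hn⟩ 2, ha, ?_, ?_⟩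
  · intro h
    have := h.2
    rw [quad_single] at this
    omega
  · intro b hb
    have hb' : red n b ∈ C := hb
    have h := two_dvd_sum_mul hC hb' ha
    have h2 := even_quad b
    by_cases hq : 4 ∣ quad b
    · exact Or.inr ⟨hb', hq⟩
    · refine Or.inl ⟨by rw [map_add]; exact add_mem hb' ha, ?_⟩
      rw [quad_add, quad_single]
      omega

theorem ker_red (n : ℕ) :
    (red n).ker = (nsmulAddMonoidHom (α := Fin n → ℤ) 2).range := by
  ext v
  simp only [AddMonoidHom.mem_ker, AddMonoidHom.mem_range, nsmulAddMonoidHom_apply]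
  constructor
  · intro h
    refine ⟨fun i => v i / 2, funext fun i => ?_⟩
    have h0 := psi_red v i
    rw [h] at h0
    simp only [psi, Pi.zero_apply, ZMod.val_zero, Nat.cast_zero] at h0
    simp only [nsmul_eq_mul, Nat.cast_ofNat, Pi.mul_apply, Pi.ofNat_apply]
    omega
  · rintro ⟨w, rfl⟩
    rw [map_nsmul]
    ext i
    simp [show (2 : ZMod 2) = 0 from rfl]

theorem index_ker_red (n : ℕ) : (red n).ker.index = 2 ^ n := by
  rw [AddSubgroup.index_ker, AddMonoidHom.range_eq_top_of_surjective _ (red_surjective n),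
    AddSubgroup.card_top, Nat.card_fun, Nat.card_zmod, Nat.card_fin]

theorem two_smul_ne_two_smul_add_one (hn : 0 < n) (x y : Fin n → ℤ) : 2 • x ≠ 2 • y + 1 := by
  intro h
  have := congrFun h ⟨0, hn⟩
  simp only [Pi.add_apply, nsmul_eq_mul, Nat.cast_ofNat, Pi.mul_apply, Pi.ofNat_apply] at this
  omega

theorem two_smul_mem_Gamma_iff (hC : (C : Set (Fin n → ZMod 2)) = dualCode C) (hn : 0 < n)
    (w : Fin n → ℤ) : 2 • w ∈ Gamma (C : Set (Fin n → ZMod 2)) ↔ w ∈ evenHalf hC := by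
  rw [mem_Gamma_iff_s12]
  constructor
  · rintro (⟨x, hx, h⟩ | ⟨x, hx, h⟩)
    · rwa [smul_right_injective (Fin n → ℤ) two_ne_zero hx]
    · exact absurd hx (two_smul_ne_two_smul_add_one hn _ _)
  · exact fun h => Or.inl ⟨w, rfl, h⟩

theorem map_evenHalf_le (hC : (C : Set (Fin n → ZMod 2)) = dualCode C) :
    (evenHalf hC).map (nsmulAddMonoidHom 2) ≤ gammaSubgroup hC := by
  rintro _ ⟨w, hw, rfl⟩
  exact (mem_Gamma_iff_s12 _ _).2 (Or.inl ⟨w, rfl, hw⟩)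

theorem relIndex_map_evenHalf (hC : (C : Set (Fin n → ZMod 2)) = dualCode C) (hn : 0 < n) :
    ((evenHalf hC).map (nsmulAddMonoidHom 2)).relIndex (gammaSubgroup hC) = 2 := by
  have ha : 2 • Pi.single ⟨0, hn⟩ 2 + 1 ∈ gammaSubgroup hC :=
    (mem_Gamma_iff_s12 _ _).2 <| Or.inr ⟨Pi.single ⟨0, hn⟩ 2, rfl,
      by rw [red_single_two]; exact zero_mem C, by rw [quad_single]; norm_num⟩
  refine AddSubgroup.relIndex_eq_two_iff_exists_notMem_and.2 ⟨_, ha, ?_, ?_⟩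
  · rintro ⟨w, -, hw⟩
    exact two_smul_ne_two_smul_add_one hn _ _ hw
  · intro b hb
    rcases (mem_Gamma_iff_s12 _ _).1 hb with ⟨w, rfl, hw⟩ | ⟨w, rfl, -⟩
    · exact Or.inr ⟨w, hw, rfl⟩
    · have h : 2 • w + 1 + (2 • Pi.single ⟨0, hn⟩ 2 + 1) =
          2 • (w + Pi.single ⟨0, hn⟩ 2 + 1) := by
        rw [smul_add, smul_add, two_nsmul (1 : Fin n → ℤ)]
        abel
      have hab := add_mem hb ha
      rw [h] at hab ⊢
      exact Or.inl ⟨_, (two_smul_mem_Gamma_iff hC hn _).1 hab, rfl⟩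

theorem index_gammaSubgroup (hC : (C : Set (Fin n → ZMod 2)) = dualCode C) (hn : 0 < n) :
    (gammaSubgroup hC).index = 2 ^ finrank (ZMod 2) C * 2 ^ n := by
  have h := AddSubgroup.relIndex_mul_index (map_evenHalf_le hC)
  have hinj : Function.Injective (nsmulAddMonoidHom (α := Fin n → ℤ) 2) :=
    smul_right_injective (Fin n → ℤ) two_ne_zero
  rw [relIndex_map_evenHalf hC hn, AddSubgroup.index_map_of_injective _ hinj, ← ker_red,
    index_ker_red, index_evenHalf hC hn, mul_assoc] at h
  exact Nat.eq_of_mul_eq_mul_left two_pos h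

theorem wt_red_le_sum_sq (w : Fin n → ℤ) : (wt (red n w) : ℤ) ≤ ∑ i, w i ^ 2 := by
  rw [wt_eq_sum_psi]
  refine sum_le_sum fun i _ => ?_
  rw [psi_red]
  rcases eq_or_ne (w i) 0 with h | h
  · simp [h]
  · have : 0 < w i ^ 2 := by positivity
    omega

theorem four_le_sum_sq_of_red_eq_zero {w : Fin n → ℤ} (hw : red n w = 0) (h0 : w ≠ 0)
    (hq : 4 ∣ quad w) : 4 ≤ ∑ i, w i ^ 2 := by
  have h : w ∈ (red n).ker := hw
  rw [ker_red] at h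
  obtain ⟨u, rfl⟩ := h
  obtain ⟨j, hj⟩ : ∃ j, u j ≠ 0 := by
    by_contra! hu
    exact h0 (by rw [show u = 0 from funext hu, map_zero])
  have hpos : 0 < u j ^ 2 := by positivity
  have := single_le_sum (f := fun i => u i ^ 2) (fun i _ => sq_nonneg _) (mem_univ j)
  simp only [nsmulAddMonoidHom_apply, nsmul_eq_mul, Nat.cast_ofNat, Pi.mul_apply, Pi.ofNat_apply,
    sum_sq_two_mul]
  omega

/-- Every vector of the even part of the constellation has squared norm at least `16`. -/
theorem sixteen_le_sum_sq_even {w : Fin n → ℤ} (hmin : ∀ c ∈ C, c ≠ 0 → 4 ≤ wt c)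
    (hw : red n w ∈ C) (hq : 4 ∣ quad w) (h0 : w ≠ 0) :
    16 ≤ ∑ i, (2 * w i) ^ 2 := by
  rw [sum_sq_two_mul]
  have h : 4 ≤ ∑ i, w i ^ 2 := by
    by_cases hr : red n w = 0
    · exact four_le_sum_sq_of_red_eq_zero hr h0 hq
    · have := hmin _ hw hr
      have := wt_red_le_sum_sq w
      omega
  omega

theorem length_le_sum_sq_odd (w : Fin n → ℤ) : (n : ℤ) ≤ ∑ i, (2 * w i + 1) ^ 2 := by
  have h : ∑ _i : Fin n, (1 : ℤ) ≤ ∑ i, (2 * w i + 1) ^ 2 := by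
    refine sum_le_sum fun i _ => ?_
    have : 0 < (2 * w i + 1) ^ 2 := by
      have : 2 * w i + 1 ≠ 0 := by omega
      positivity
    omega
  simpa using h

end SelfDual

/-- with `C2` any self-dual linear binary code of length 14 and minimum
Hamming weight 4, `Γ` is an additive subgroup of `ℤ^14` of index `2^21`, its minimum
squared norm of a nonzero point is `16`, and its Hermite invariant
`d_min^2 / vol^{2/14}` equals `2`. -/
theorem constructionCstar_dim14
    (C2 : Submodule (ZMod 2) (Fin 14 → ZMod 2))
    (hsd : (C2 : Set (Fin 14 → ZMod 2)) = dualCode (C2 : Set (Fin 14 → ZMod 2)))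
    (hmin : IsLeast {w : ℕ | ∃ c ∈ C2, c ≠ 0 ∧ w = wt c} 4) :
    ∃ H : AddSubgroup (Fin 14 → ℤ),
      Gamma (C2 : Set (Fin 14 → ZMod 2)) = ↑H ∧
      H.index = 2 ^ 21 ∧
      IsLeast {m : ℤ | ∃ v ∈ Gamma (C2 : Set (Fin 14 → ZMod 2)),
        v ≠ 0 ∧ m = ∑ i, (v i) ^ 2} 16 ∧
      (16 : ℝ) / ((H.index : ℝ) ^ ((2 : ℝ) / 14)) = 2 := by
  have hmin' : ∀ c ∈ C2, c ≠ 0 → 4 ≤ wt c := fun c hc h0 => hmin.2 ⟨c, hc, h0, rfl⟩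
  have hrank := finrank_of_selfDual hsd
  have hindex : (gammaSubgroup hsd).index = 2 ^ 21 := by
    rw [index_gammaSubgroup hsd (by norm_num),
      show finrank (ZMod 2) C2 = 7 by omega]
    norm_num
  refine ⟨gammaSubgroup hsd, rfl, hindex, ⟨?_, ?_⟩, ?_⟩
  · obtain ⟨c, hc, h0, hw⟩ := hmin.1
    have hpsi : ∀ i, psi c i * (psi c i - 1) = 0 := fun i => by
      rcases psi_eq_zero_or_one c i with h | h <;> simp [h]
    have hred : red 14 (psi c) = c := by
      ext i
      simp [psi]
    refine ⟨2 • psi c, (mem_Gamma_iff_s12 _ _).2 (Or.inl ⟨psi c, rfl, by rwa [hred], ?_⟩), ?_, ?_⟩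
    · simp [quad, hpsi]
    · intro h
      apply h0
      rw [← hred, (smul_eq_zero.1 h).resolve_left two_ne_zero, map_zero]
    · simp only [nsmul_eq_mul, Nat.cast_ofNat, Pi.mul_apply, Pi.ofNat_apply, sum_sq_two_mul]
      have : ∑ i, psi c i ^ 2 = ∑ i, psi c i :=
        sum_congr rfl fun i _ => by linarith [hpsi i]
      rw [this, ← wt_eq_sum_psi, ← hw]
      norm_num
  · rintro m ⟨v, hv, h0, rfl⟩
    rcases (mem_Gamma_iff_s12 _ _).1 hv with ⟨w, rfl, hw, hq⟩ | ⟨w, rfl, hw, hq⟩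
    · simpa using sixteen_le_sum_sq_even hmin' hw hq (by rintro rfl; simp at h0)
    · have h1 := length_le_sum_sq_odd w
      have h2 := sum_sq_two_mul_add_one w
      have h3 := two_dvd_sum hsd hw
      simp only [Pi.add_apply, nsmul_eq_mul, Nat.cast_ofNat, Pi.mul_apply, Pi.ofNat_apply]
      omega
  · rw [hindex]
    have : (((2 ^ 21 : ℕ) : ℝ) ^ ((2 : ℝ) / 14)) = 8 := by
      rw [Nat.cast_pow, Nat.cast_ofNat, ← Real.rpow_natCast, ← Real.rpow_mul (by norm_num)]
      norm_num
    rw [this]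
    norm_num
end

section
/- Let C2 ⊆ F_2^4 be the Reed–Muller code RM(1,2), namely the [4,3,2] code C2 = {(0,0,0,0),(1,0,1,0),(0,1,0,1),(1,1,1,1),(0,0,1,1),(0,1,1,0),(1,0,0,1),(1,1,0,0)}, and let Γ ⊆ ℤ^4 be the Construction C* constellation built from the 3-level code C determined by C2. Then Γ is not closed under addition, hence is not a lattice: the points (4,6,0,2) and (4,4,2,2) belong to Γ but their sum (8,10,2,4) does not belong to Γ. -/
open Finset

/-- The Reed–Muller code RM(1,2), a `[4,3,2]` binary code, given as an explicit set. -/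
def RM12 : Set (Fin 4 → ZMod 2) :=
  {![0,0,0,0], ![1,0,1,0], ![0,1,0,1], ![1,1,1,1],
   ![0,0,1,1], ![0,1,1,0], ![1,0,0,1], ![1,1,0,0]}

/-- The bits in the 2-adic expansion of an integer determine the vectors of a decomposition
`psi c1 + 2 psi c2 + 4 psi c3 + 8 z`, coordinate by coordinate. -/
theorem val_eq_of_decomposition {n : ℕ} {v z : Fin n → ℤ} {c1 c2 c3 : Fin n → ZMod 2}
    (h : v = psi c1 + 2 • psi c2 + 4 • psi c3 + 8 • z) (i : Fin n) :
    ((c1 i).val : ℤ) = v i % 2 ∧ ((c3 i).val : ℤ) = v i / 4 % 2 := by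
  have hi : v i = (c1 i).val + 2 * (c2 i).val + 4 * (c3 i).val + 8 * z i := by
    simp [h, psi]
  have h1 := (c1 i).val_lt
  have h2 := (c2 i).val_lt
  have h3 := (c3 i).val_lt
  omega

theorem toReal_injective {n : ℕ} : Function.Injective (toReal : (Fin n → ℤ) → Fin n → ℝ) :=
  fun _ _ h => funext fun i => Int.cast_injective (congrFun h i)

theorem toReal_add {n : ℕ} (x y : Fin n → ℤ) : toReal (x + y) = toReal x + toReal y :=
  funext fun i => Int.cast_add (x i) (y i)

/-- If the real image of a set of integer vectors is an additive subgroup, the set is closed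
under addition. -/
theorem add_mem_of_toReal_image_eq {n : ℕ} {S : Set (Fin n → ℤ)} {H : AddSubgroup (Fin n → ℝ)}
    (hH : toReal '' S = ↑H) {x y : Fin n → ℤ} (hx : x ∈ S) (hy : y ∈ S) : x + y ∈ S := by
  have mem_iff (w : Fin n → ℤ) : toReal w ∈ H ↔ w ∈ S := by
    rw [← SetLike.mem_coe, ← hH, toReal_injective.mem_set_image]
  rw [← mem_iff, toReal_add]
  exact H.add_mem ((mem_iff x).2 hx) ((mem_iff y).2 hy)

/-- with `C2 = RM(1,2)`, the points `(4,6,0,2)` and `(4,4,2,2)` belong to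
`Γ` but their sum `(8,10,2,4)` does not; hence `Γ` is not closed under addition and is
not a lattice (not an additive subgroup of `ℝ^4`). -/
theorem constructionCstar_RM12_not_lattice :
    (![4,6,0,2] : Fin 4 → ℤ) ∈ Gamma RM12 ∧
    (![4,4,2,2] : Fin 4 → ℤ) ∈ Gamma RM12 ∧
    (![8,10,2,4] : Fin 4 → ℤ) ∉ Gamma RM12 ∧
    ¬ (∀ x ∈ Gamma RM12, ∀ y ∈ Gamma RM12, x + y ∈ Gamma RM12) ∧
    ¬ ∃ H : AddSubgroup (Fin 4 → ℝ), toReal '' Gamma RM12 = ↑H := by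
  have hx : (![4,6,0,2] : Fin 4 → ℤ) ∈ Gamma RM12 :=
    ⟨0, ![0,1,0,1], ![1,1,0,0], 0, ⟨by simp [RM12], Or.inl ⟨rfl, by decide⟩⟩, by decide⟩
  have hy : (![4,4,2,2] : Fin 4 → ℤ) ∈ Gamma RM12 :=
    ⟨0, ![0,0,1,1], ![1,1,0,0], 0, ⟨by simp [RM12], Or.inl ⟨rfl, by decide⟩⟩, by decide⟩
  have hxy : (![8,10,2,4] : Fin 4 → ℤ) ∉ Gamma RM12 := by
    rintro ⟨c1, c2, c3, z, ⟨-, ⟨-, heven⟩ | ⟨rfl, -⟩⟩, hv⟩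
    · have hc3 : c3 = ![0,0,0,1] := by
        funext i
        apply ZMod.val_injective
        zify
        rw [(val_eq_of_decomposition hv i).2]
        revert i
        decide
      subst hc3
      revert heven
      decide
    · exact absurd (val_eq_of_decomposition hv 0).1 (by decide)
  have hsum : (![4,6,0,2] : Fin 4 → ℤ) + ![4,4,2,2] = ![8,10,2,4] := by decide
  refine ⟨hx, hy, hxy, fun h => hxy (hsum ▸ h _ hx _ hy), ?_⟩
  rintro ⟨H, hH⟩
  exact hxy (hsum ▸ add_mem_of_toReal_image_eq hH hx hy)
end
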